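/- Let R be an integral domain, Y a Stone space, f : Y → Σ(R) continuous with respect to the Zariski topology, and suppose that f(y) is a local ring for every y ∈ Y. Let A = {a ∈ LocallyConstant(Y, R) : a(y) ∈ f(y) for all y ∈ Y} be the patch algebra of the patch bundle f. Then A is a Gelfand ring: every prime ideal of A is contained in exactly one maximal ideal of A. -/

import Mathlib

/-- The Zariski topology on the set of subrings of a commutative ring `R`,
generated by the sets `{S | r ∈ S}` for `r ∈ R`. -/
instance zariskiTopology (R : Type*) [CommRing R] : TopologicalSpace (Subring R) :=
  TopologicalSpace.generateFrom {U : Set (Subring R) | ∃ r : R, U = {S : Subring R | r ∈ S}}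

/-- The patch algebra of a family `f` of subrings of `R` indexed by a topological
space `Y`: the subring of `LocallyConstant Y R` consisting of the locally constant
functions `a` with `a y ∈ f y` for all `y`. -/
def patchAlgebra (Y : Type*) [TopologicalSpace Y] (R : Type*) [CommRing R]
    (f : Y → Subring R) : Subring (LocallyConstant Y R) where
  carrier := {a : LocallyConstant Y R | ∀ y : Y, a y ∈ f y}
  zero_mem' := fun y => by simpa using zero_mem (f y)
  one_mem' := fun y => by simpa using one_mem (f y)
  add_mem' := fun {a b} ha hb y => by simpa using add_mem (ha y) (hb y)
  mul_mem' := fun {a b} ha hb y => by simpa using mul_mem (ha y) (hb y)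
  neg_mem' := fun {a} ha y => by simpa using neg_mem (ha y)

theorem pa_isOpen {R : Type*} [CommRing R] {Y : Type*} [TopologicalSpace Y]
    (f : Y → Subring R) (hf : Continuous f) (a : LocallyConstant Y R) :
    IsOpen {y | ∃ s ∈ f y, a y * s = 1} := by
  rw [isOpen_iff_forall_mem_open]
  rintro y ⟨s, hs, h⟩
  refine ⟨a ⁻¹' {a y} ∩ f ⁻¹' {S | s ∈ S}, ?_, ?_, rfl, hs⟩
  · rintro z ⟨hz, hz'⟩
    have hz : a z = a y := hz
    exact ⟨s, hz', by rw [hz, h]⟩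
  · have ho : IsOpen {S : Subring R | s ∈ S} :=
      TopologicalSpace.isOpen_generateFrom_of_mem ⟨s, rfl⟩
    exact (a.isLocallyConstant _).inter (ho.preimage hf)

theorem pa_div {R : Type*} [CommRing R] {Y : Type*} [TopologicalSpace Y]
    (f : Y → Subring R) (a : LocallyConstant Y R) {C : Set Y} (hC : IsClopen C)
    (h : C ⊆ {y | ∃ s ∈ f y, a y * s = 1}) :
    ∃ b ∈ patchAlgebra Y R f, a * b = LocallyConstant.charFn R hC := by
  classical
  refine ⟨a.map Ring.inverse * LocallyConstant.charFn R hC, fun y => ?_, ?_⟩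
  · by_cases hy : y ∈ C
    · obtain ⟨s, hs, e⟩ := h hy
      have : Ring.inverse (a y) = s := by
        have hu := Ring.inverse_mul_cancel _ (IsUnit.of_mul_eq_one s e)
        calc Ring.inverse (a y) = Ring.inverse (a y) * (a y * s) := by rw [e, mul_one]
          _ = s := by rw [← mul_assoc, hu, one_mul]
      simpa [LocallyConstant.coe_charFn, hy, this] using hs
    · simp [LocallyConstant.coe_charFn, hy, zero_mem]
  · ext y
    by_cases hy : y ∈ C
    · obtain ⟨s, hs, e⟩ := h hy
      have : a y * Ring.inverse (a y) = 1 := Ring.mul_inverse_cancel _ (IsUnit.of_mul_eq_one s e)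
      simp [LocallyConstant.coe_charFn, hy, this]
    · simp [LocallyConstant.coe_charFn, hy]

theorem pa_exists {R : Type*} [CommRing R]
    {Y : Type*} [TopologicalSpace Y] [CompactSpace Y] [T2Space Y]
    [TotallyDisconnectedSpace Y] (f : Y → Subring R) (hf : Continuous f)
    (hloc : ∀ y : Y, IsLocalRing (f y)) (a c : patchAlgebra Y R f) (hac : a + c = 1) :
    ∃ b d : patchAlgebra Y R f, a * b * (c * d) = 0 ∧ a * b + c * d = 1 := by
  classical
  have hac' : ∀ y, a.1 y + c.1 y = 1 := fun y => by
    have := congrArg (fun x : patchAlgebra Y R f => x.1 y) hac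
    simpa using this
  have key : ∀ (y : Y) (x : f y), IsUnit x → ∃ s ∈ f y, x.1 * s = 1 := by
    intro y x hx
    obtain ⟨s, hs⟩ := hx.exists_right_inv
    exact ⟨s.1, s.2, by simpa using congrArg Subtype.val hs⟩
  obtain ⟨C, hC, h1, h2⟩ := exists_clopen_of_closed_subset_open
    (pa_isOpen f hf c.1).isClosed_compl (pa_isOpen f hf a.1) (by
      intro y hy
      have := hloc y
      have hs : (⟨a.1 y, a.2 y⟩ : f y) + ⟨c.1 y, c.2 y⟩ = 1 := Subtype.ext (hac' y)
      rcases IsLocalRing.isUnit_or_isUnit_of_add_one hs with h | h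
      · exact key y _ h
      · exact absurd (key y _ h) hy)
  obtain ⟨b, hb, eb⟩ := pa_div f a.1 hC h2
  obtain ⟨d, hd, ed⟩ := pa_div f c.1 hC.compl (Set.compl_subset_comm.1 h1)
  refine ⟨⟨b, hb⟩, ⟨d, hd⟩, ?_, ?_⟩
  · apply Subtype.ext
    change a.1 * b * (c.1 * d) = 0
    rw [eb, ed]
    ext y
    by_cases hy : y ∈ C <;> simp [LocallyConstant.coe_charFn, hy]
  · apply Subtype.ext
    change a.1 * b + (c.1 * d) = 1
    rw [eb, ed]
    ext y
    by_cases hy : y ∈ C <;> simp [LocallyConstant.coe_charFn, hy]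

/-- Let `R` be an integral domain, `Y` a Stone space, `f : Y → Σ(R)` continuous for the
Zariski topology with each `f y` a local ring, and `A` the patch algebra of the patch
bundle `f`.  Then `A` is a Gelfand ring: every prime ideal of `A` is contained in
exactly one maximal ideal of `A`. -/
theorem patchAlgebra_gelfand (R : Type*) [CommRing R] [IsDomain R]
    (Y : Type*) [TopologicalSpace Y] [CompactSpace Y] [T2Space Y]
    [TotallyDisconnectedSpace Y] (f : Y → Subring R) (hf : Continuous f)
    (hloc : ∀ y : Y, IsLocalRing (f y)) :
    ∀ p : Ideal (patchAlgebra Y R f), p.IsPrime →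
      ∃! M : Ideal (patchAlgebra Y R f), M.IsMaximal ∧ p ≤ M := by
  intro p hp
  obtain ⟨M, hM, hpM⟩ := p.exists_le_maximal hp.ne_top
  refine ⟨M, ⟨hM, hpM⟩, ?_⟩
  rintro N ⟨hN, hpN⟩
  by_contra hne
  obtain ⟨a, ha, c, hc, hac⟩ := Ideal.isCoprime_iff_exists.1
    (Ideal.isCoprime_iff_sup_eq.2 (hN.coprime_of_ne hM hne))
  obtain ⟨b, d, h0, h1⟩ := pa_exists f hf hloc a c hac
  have hab : a * b ∈ N := N.mul_mem_right b ha
  have hcd : c * d ∈ M := M.mul_mem_right d hc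
  rcases hp.mem_or_mem (h0 ▸ p.zero_mem : a * b * (c * d) ∈ p) with h | h
  · exact hM.ne_top ((Ideal.eq_top_iff_one _).2 (h1 ▸ M.add_mem (hpM h) hcd))
  · exact hN.ne_top ((Ideal.eq_top_iff_one _).2 (h1 ▸ N.add_mem hab (hpN h)))
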